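/- arXiv:1502.06729 — 3 statements merged into one kernel-verified Lean document; each statement's English description precedes it below -/
import Mathlib

section
/- Let μ be a valuation on 𝒞ⁿ which is rigid motion invariant, monotone decreasing, and simple. Then there exists a nonnegative decreasing function f : ℝ → ℝ such that μ(t + I_K) = f(t)·vol_n(K) for every convex body K ⊆ ℝⁿ and every t ∈ ℝ. If moreover μ is m-continuous, then f is right-continuous. -/
open MeasureTheory Filter Set
open scoped ENNReal RealInnerProductSpace

noncomputable section

abbrev En (n : ℕ) : Type := EuclideanSpace ℝ (Fin n)

def IsCn {n : ℕ} (u : En n → EReal) : Prop :=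
  (∀ x, u x ≠ ⊥) ∧
  (∀ x y : En n, ∀ a b : ℝ, 0 ≤ a → 0 ≤ b → a + b = 1 →
    u (a • x + b • y) ≤ (a : EReal) * u x + (b : EReal) * u y) ∧
  LowerSemicontinuous u ∧
  Tendsto u (cocompact (En n)) atTop

def IsValuation {n : ℕ} (μ : (En n → EReal) → ℝ) : Prop :=
  μ (fun _ => ⊤) = 0 ∧
  ∀ u v : En n → EReal, IsCn u → IsCn v → IsCn (fun x => min (u x) (v x)) →
    μ (fun x => max (u x) (v x)) + μ (fun x => min (u x) (v x)) = μ u + μ v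

def RigidInvariant {n : ℕ} (μ : (En n → EReal) → ℝ) : Prop :=
  ∀ u : En n → EReal, IsCn u → ∀ (R : En n ≃ₗᵢ[ℝ] En n) (x₀ : En n),
    μ (fun x => u (R x + x₀)) = μ u

def MonotoneDecr {n : ℕ} (μ : (En n → EReal) → ℝ) : Prop :=
  ∀ u v : En n → EReal, IsCn u → IsCn v → (∀ x, v x ≤ u x) → μ u ≤ μ v

def MContinuous {n : ℕ} (μ : (En n → EReal) → ℝ) : Prop :=
  ∀ (u : En n → EReal) (useq : ℕ → En n → EReal), IsCn u → (∀ i, IsCn (useq i)) →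
    (∀ i x, useq (i + 1) x ≤ useq i x) → (∀ i x, u x ≤ useq i x) →
    (∀ x ∈ intrinsicInterior ℝ {y | u y ≠ ⊤},
      Tendsto (fun i => useq i x) atTop (nhds (u x))) →
    Tendsto (fun i => μ (useq i)) atTop (nhds (μ u))

def HomogVal {n : ℕ} (μ : (En n → EReal) → ℝ) (α : ℝ) : Prop :=
  ∀ u : En n → EReal, IsCn u → ∀ l : ℝ, 0 < l →
    μ (fun x => u (l⁻¹ • x)) = l ^ α * μ u

def SimpleVal {n : ℕ} (μ : (En n → EReal) → ℝ) : Prop :=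
  ∀ u : En n → EReal, IsCn u → interior {x | u x ≠ ⊤} = ∅ → μ u = 0

def IsConvexBody {n : ℕ} (K : Set (En n)) : Prop :=
  K.Nonempty ∧ IsCompact K ∧ Convex ℝ K

open Classical in
noncomputable def constOn {n : ℕ} (t : ℝ) (K : Set (En n)) : En n → EReal :=
  fun x => if x ∈ K then (t : EReal) else ⊤

open Classical in
noncomputable def restrictTo {n : ℕ} (u : En n → EReal) (K : Set (En n)) : En n → EReal :=
  fun x => if x ∈ K then u x else ⊤

def IsConvexPartition {n : ℕ} (K : Set (En n)) (P : Finset (Set (En n))) : Prop :=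
  (∀ Q ∈ P, IsConvexBody Q) ∧ (⋃ Q ∈ P, Q) = K ∧
  ∀ Q ∈ P, ∀ R ∈ P, Q ≠ R → interior (Q ∩ R) = ∅

def IsInductivePartition {n : ℕ} (K : Set (En n)) (P : Finset (Set (En n))) : Prop :=
  IsConvexPartition K P ∧
  ∃ (l : ℕ) (H : Fin (l + 1) → Set (En n)),
    H (Fin.last l) = K ∧ (∀ i, IsConvexBody (H i)) ∧
    ∀ i : Fin (l + 1), H i ∈ P ∨ ∃ j k : Fin (l + 1), j < i ∧ k < i ∧
      H i = H j ∪ H k ∧ interior (H j ∩ H k) = ∅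

def IsPolytope {n : ℕ} (P : Set (En n)) : Prop :=
  ∃ S : Finset (En n), S.Nonempty ∧ P = convexHull ℝ (S : Set (En n))

def ContainsFacet {n : ℕ} (v : En n) (c : ℝ) (Q : Set (En n)) : Prop :=
  (Q ⊆ {x | ⟪v, x⟫ ≤ c} ∨ Q ⊆ {x | c ≤ ⟪v, x⟫}) ∧
  Module.finrank ℝ (affineSpan ℝ (Q ∩ {x | ⟪v, x⟫ = c})).direction = n - 1

open Classical in
noncomputable def refinePartition {n : ℕ} (P : Finset (Set (En n))) (v : En n) (c : ℝ) :
    Finset (Set (En n)) :=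
  ((P.image fun Q => Q ∩ {x | ⟪v, x⟫ ≤ c}).filter fun Q => (interior Q).Nonempty) ∪
  ((P.image fun Q => Q ∩ {x | c ≤ ⟪v, x⟫}).filter fun Q => (interior Q).Nonempty)


/-- A monotone, translation invariant set function on compact convex subsets of `ι → ℝ` which is
additive when a set is cut by a coordinate hyperplane. -/
structure IsMonotoneCutAdditive {ι : Type*} (ν : Set (ι → ℝ) → ℝ) : Prop where
  empty : ν ∅ = 0
  mono : ∀ K L : Set (ι → ℝ), IsCompact K → Convex ℝ K → IsCompact L → Convex ℝ L →
    K ⊆ L → ν K ≤ ν L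
  cut : ∀ K : Set (ι → ℝ), IsCompact K → Convex ℝ K → ∀ (i : ι) (a : ℝ),
    ν (K ∩ {x | x i ≤ a}) + ν (K ∩ {x | a ≤ x i}) = ν K
  translate : ∀ K : Set (ι → ℝ), IsCompact K → Convex ℝ K → ∀ v : ι → ℝ,
    ν ((fun x => x + v) ⁻¹' K) = ν K

/-- An additive function on `[0, ∞)` which is nonnegative is linear. -/
theorem eq_mul_of_add_of_nonneg {φ : ℝ → ℝ} (hφ : ∀ x, 0 ≤ x → 0 ≤ φ x)
    (hadd : ∀ x y, 0 ≤ x → 0 ≤ y → φ (x + y) = φ x + φ y) {x : ℝ} (hx : 0 ≤ x) :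
    φ x = x * φ 1 := by
  have hmono : ∀ a b, 0 ≤ a → a ≤ b → φ a ≤ φ b := fun a b ha hab => by
    have h := hadd a (b - a) ha (sub_nonneg.2 hab)
    have h' := hφ (b - a) (sub_nonneg.2 hab)
    rw [add_sub_cancel] at h
    linarith
  have hnat : ∀ (k : ℕ) (y : ℝ), 0 ≤ y → φ (k * y) = k * φ y := by
    intro k y hy
    induction k with
    | zero =>
      have h := hadd 0 0 le_rfl le_rfl
      simp only [add_zero] at h
      simp only [Nat.cast_zero, zero_mul]
      linarith
    | succ k ih =>
      push_cast
      rw [add_mul, one_mul, hadd _ _ (by positivity) hy, ih]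
      ring
  by_contra hne
  have hd : 0 < |φ x - x * φ 1| := abs_pos.2 (sub_ne_zero.2 hne)
  obtain ⟨k, hk⟩ := exists_nat_gt (φ 1 / |φ x - x * φ 1|)
  rw [div_lt_iff₀ hd] at hk
  have hkx : 0 ≤ (k : ℝ) * x := by positivity
  have h₁ := Nat.floor_le hkx
  have h₂ := (Nat.lt_floor_add_one ((k : ℝ) * x)).le
  have h₃ := hmono _ _ (by positivity) h₁
  have h₄ := hmono _ _ hkx h₂
  have h₅ := hnat ⌊(k : ℝ) * x⌋₊ 1 zero_le_one
  have h₆ := hnat (⌊(k : ℝ) * x⌋₊ + 1) 1 zero_le_one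
  have h₇ := hnat k x hx
  have h1 := hφ 1 zero_le_one
  push_cast at h₆
  rw [mul_one] at h₅ h₆
  have h₈ : |(k : ℝ) * (φ x - x * φ 1)| ≤ φ 1 := by
    rw [abs_le]
    constructor <;> nlinarith
  rw [abs_mul, Nat.abs_cast] at h₈
  linarith

namespace IsMonotoneCutAdditive

variable {ι : Type*} {ν : Set (ι → ℝ) → ℝ}

theorem nonneg (h : IsMonotoneCutAdditive ν) {K : Set (ι → ℝ)} (hK : IsCompact K)
    (hK' : Convex ℝ K) : 0 ≤ ν K :=
  h.empty ▸ h.mono ∅ K isCompact_empty convex_empty hK hK' (empty_subset K)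

theorem Icc_eq_Icc_zero (h : IsMonotoneCutAdditive ν) (l u : ι → ℝ) :
    ν (Icc l u) = ν (Icc 0 (u - l)) := by
  rw [← h.translate (Icc l u) isCompact_Icc (convex_Icc l u) l]
  simp

theorem Icc_update_add [DecidableEq ι] (h : IsMonotoneCutAdditive ν) (b : ι → ℝ) (i : ι)
    {x y : ℝ} (hx : 0 ≤ x) (hy : 0 ≤ y) :
    ν (Icc 0 (Function.update b i (x + y))) =
      ν (Icc 0 (Function.update b i x)) + ν (Icc 0 (Function.update b i y)) := by
  rw [← h.cut _ isCompact_Icc (convex_Icc _ _) i x]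
  congr 1
  · congr 1
    ext z
    simp only [mem_inter_iff, mem_Icc, mem_ofPred_eq, le_update_iff]
    constructor
    · rintro ⟨⟨h0, -, h2⟩, h3⟩
      exact ⟨h0, h3, h2⟩
    · rintro ⟨h0, h3, h2⟩
      exact ⟨⟨h0, by linarith, h2⟩, h3⟩
  · have : Icc 0 (Function.update b i (x + y)) ∩ {z | x ≤ z i} =
        Icc (Function.update (0 : ι → ℝ) i x) (Function.update b i (x + y)) := by
      ext z
      simp only [mem_inter_iff, mem_Icc, mem_ofPred_eq, update_le_iff]
      constructor
      · rintro ⟨⟨h0, h1⟩, h2⟩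
        exact ⟨⟨h2, fun j _ => h0 j⟩, h1⟩
      · rintro ⟨⟨h2, h0⟩, h1⟩
        refine ⟨⟨fun j => ?_, h1⟩, h2⟩
        by_cases hj : j = i
        · subst hj; exact hx.trans h2
        · exact h0 j hj
    rw [this, h.Icc_eq_Icc_zero]
    congr 2
    ext j
    by_cases hj : j = i
    · subst hj; simp
    · simp [hj]

theorem Icc_zero_eq_prod_mul [Fintype ι] (h : IsMonotoneCutAdditive ν) {a : ι → ℝ}
    (ha : 0 ≤ a) : ν (Icc 0 a) = (∏ i, a i) * ν (Icc 0 1) := by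
  classical
  have key : ∀ s : Finset ι, ν (Icc 0 a) = (∏ i ∈ s, a i) * ν (Icc 0 (s.piecewise (1 : ι → ℝ) a)) := by
    intro s
    induction s using Finset.induction_on with
    | empty => simp
    | insert i s hi ih =>
      have hlin := eq_mul_of_add_of_nonneg
        (φ := fun x => ν (Icc 0 (Function.update (s.piecewise (1 : ι → ℝ) a) i x)))
        (fun x _ => h.nonneg isCompact_Icc (convex_Icc _ _))
        (fun x y hx hy => h.Icc_update_add _ i hx hy) (ha i)
      have hself : Function.update (s.piecewise (1 : ι → ℝ) a) i (a i) = s.piecewise (1 : ι → ℝ) a :=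
        Function.update_eq_self_iff.2 (by simp [hi])
      simp only [hself] at hlin
      rw [ih, hlin, Finset.prod_insert hi, Finset.piecewise_insert, Pi.one_apply]
      ring
  have := key Finset.univ
  rwa [Finset.piecewise_univ] at this

open BoxIntegral in
theorem box_Icc [Fintype ι] (h : IsMonotoneCutAdditive ν) (J : Box ι) :
    ν (Box.Icc J) = ν (Icc 0 1) * (volume (J : Set (ι → ℝ))).toReal := by
  rw [Box.Icc_def, h.Icc_eq_Icc_zero, h.Icc_zero_eq_prod_mul (sub_nonneg.2 J.lower_le_upper),
    Box.volume_apply', mul_comm]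
  simp

open BoxIntegral in
/-- The box additive function `J ↦ ν (K ∩ J)`. -/
def toBoxAdditive [Finite ι] (h : IsMonotoneCutAdditive ν) {K : Set (ι → ℝ)}
    (hK : IsCompact K) (hK' : Convex ℝ K) : BoxAdditiveMap ι ℝ ⊤ :=
  BoxAdditiveMap.ofMapSplitAdd (fun J => ν (K ∩ Box.Icc J)) ⊤ (by
    classical
    intro I _ i x hx
    rw [Box.splitLower_def hx, Box.splitUpper_def hx]
    change ν (K ∩ Icc I.lower (Function.update I.upper i x)) +
      ν (K ∩ Icc (Function.update I.lower i x) I.upper) = ν (K ∩ Icc I.lower I.upper)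
    rw [← h.cut (K ∩ Icc I.lower I.upper) (hK.inter isCompact_Icc)
      (hK'.inter (convex_Icc _ _)) i x, inter_assoc, inter_assoc]
    congr 3
    · ext z
      simp only [mem_inter_iff, mem_Icc, mem_ofPred_eq, le_update_iff]
      constructor
      · rintro ⟨h0, h1, h2⟩
        refine ⟨⟨h0, fun j => ?_⟩, h1⟩
        by_cases hj : j = i
        · subst hj; exact h1.trans hx.2.le
        · exact h2 j hj
      · rintro ⟨⟨h0, h2⟩, h1⟩
        exact ⟨h0, h1, fun j _ => h2 j⟩
    · ext z
      simp only [mem_inter_iff, mem_Icc, mem_ofPred_eq, update_le_iff]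
      constructor
      · rintro ⟨⟨h1, h2⟩, h0⟩
        refine ⟨⟨fun j => ?_, h0⟩, h1⟩
        by_cases hj : j = i
        · subst hj; exact hx.1.le.trans h1
        · exact h2 j hj
      · rintro ⟨⟨h2, h0⟩, h1⟩
        exact ⟨⟨h1, fun j _ => h2 j⟩, h0⟩)

open BoxIntegral in
@[simp]
theorem toBoxAdditive_apply [Finite ι] (h : IsMonotoneCutAdditive ν) {K : Set (ι → ℝ)}
    (hK : IsCompact K) (hK' : Convex ℝ K) (J : Box ι) :
    h.toBoxAdditive hK hK' J = ν (K ∩ Box.Icc J) := rfl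

open BoxIntegral in
theorem abs_sub_le_of_frontier_subset [Fintype ι] (h : IsMonotoneCutAdditive ν)
    {K : Set (ι → ℝ)} (hK : IsCompact K) (hK' : Convex ℝ K) {U : Set (ι → ℝ)} (hU : IsOpen U)
    (hKU : frontier K ⊆ U) (I : Box ι) :
    |ν (K ∩ Box.Icc I) - ν (Icc 0 1) * (volume.restrict K).real I| ≤
      ν (Icc 0 1) * (volume.restrict U).real I := by
  have hc : 0 ≤ ν (Icc 0 1) := h.nonneg isCompact_Icc (convex_Icc _ _)
  let D : BoxAdditiveMap ι ℝ ⊤ :=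
    h.toBoxAdditive hK hK' - ν (Icc 0 1) • (volume.restrict K).toBoxAdditive
  let V : BoxAdditiveMap ι ℝ ⊤ := ν (Icc 0 1) • (volume.restrict U).toBoxAdditive
  change |D I| ≤ V I
  induction I using Box.subbox_induction_on with
  | H_ind J _ hJ =>
    rw [← D.sum_partition_boxes le_top (Prepartition.isPartition_splitCenter J),
      ← V.sum_partition_boxes le_top (Prepartition.isPartition_splitCenter J)]
    exact (Finset.abs_sum_le_sum_abs _ _).trans (Finset.sum_le_sum fun J' hJ' => hJ J' hJ')
  | H_nhds z _ =>
    have hV : ∀ J, 0 ≤ V J := fun J => mul_nonneg hc measureReal_nonneg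
    have hD : ∀ J : Box ι, D J =
        ν (K ∩ Box.Icc J) - ν (Icc 0 1) * (volume (J ∩ K : Set (ι → ℝ))).toReal := fun J => by
      simp [D, measureReal_def, Measure.restrict_apply J.measurableSet_coe]
    by_cases hzf : z ∈ frontier K
    · refine ⟨U, mem_nhdsWithin_of_mem_nhds (hU.mem_nhds (hKU hzf)), fun J _ m _ hJU _ => ?_⟩
      have hVJ : V J = ν (Icc 0 1) * (volume (J : Set (ι → ℝ))).toReal := by
        simp [V, measureReal_def, Measure.restrict_apply J.measurableSet_coe,
          inter_eq_left.2 (Box.coe_subset_Icc.trans hJU)]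
      have h₁ : ν (K ∩ Box.Icc J) ≤ V J := by
        rw [hVJ, ← h.box_Icc]
        exact h.mono _ _ (hK.inter isCompact_Icc) (hK'.inter (convex_Icc _ _))
          isCompact_Icc (convex_Icc _ _) inter_subset_right
      have h₂ : ν (Icc 0 1) * (volume (J ∩ K : Set (ι → ℝ))).toReal ≤ V J := by
        rw [hVJ]
        exact mul_le_mul_of_nonneg_left (ENNReal.toReal_mono (J.measure_coe_lt_top _).ne
          (measure_mono inter_subset_left)) hc
      have h₃ : 0 ≤ ν (K ∩ Box.Icc J) :=
        h.nonneg (hK.inter isCompact_Icc) (hK'.inter (convex_Icc _ _))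
      have h₄ : 0 ≤ ν (Icc 0 1) * (volume (J ∩ K : Set (ι → ℝ))).toReal :=
        mul_nonneg hc ENNReal.toReal_nonneg
      rw [hD, abs_le]
      constructor <;> linarith
    · by_cases hzK : z ∈ K
      · have hzi : z ∈ interior K := by
          by_contra hzi
          exact hzf ⟨subset_closure hzK, hzi⟩
        refine ⟨interior K, mem_nhdsWithin_of_mem_nhds (isOpen_interior.mem_nhds hzi),
          fun J _ m _ hJ _ => ?_⟩
        have hJK := hJ.trans interior_subset
        rw [hD, inter_eq_right.2 hJK, inter_eq_left.2 (Box.coe_subset_Icc.trans hJK),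
          h.box_Icc, sub_self, abs_zero]
        exact hV J
      · refine ⟨Kᶜ, mem_nhdsWithin_of_mem_nhds (hK.isClosed.isOpen_compl.mem_nhds hzK),
          fun J _ m _ hJ _ => ?_⟩
        have h₁ : K ∩ Box.Icc J = ∅ := by
          rw [inter_comm, ← disjoint_iff_inter_eq_empty]
          exact disjoint_left.2 fun x hx => hJ hx
        have h₂ : (J ∩ K : Set (ι → ℝ)) = ∅ := by
          rw [← disjoint_iff_inter_eq_empty]
          exact disjoint_left.2 fun x hx => hJ (Box.coe_subset_Icc hx)
        rw [hD, h₁, h₂, h.empty]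
        simpa using hV J

open BoxIntegral in
theorem eq_mul_volume [Fintype ι] (h : IsMonotoneCutAdditive ν) {K : Set (ι → ℝ)}
    (hK : IsCompact K) (hK' : Convex ℝ K) :
    ν K = ν (Icc 0 1) * (volume K).toReal := by
  have hc : 0 ≤ ν (Icc 0 1) := h.nonneg isCompact_Icc (convex_Icc _ _)
  obtain ⟨r, hr⟩ := hK.isBounded.subset_closedBall 0
  let I : Box ι := ⟨fun _ => -(|r| + 1), fun _ => |r| + 1, fun _ => by
    have := abs_nonneg r; linarith⟩
  have hKI : K ⊆ I := fun x hx i => by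
    have h₁ : ‖x i‖ ≤ r := (norm_le_pi_norm x i).trans (by simpa using hr hx)
    have h₂ := abs_le.1 (Real.norm_eq_abs _ ▸ h₁)
    have h₃ := le_abs_self r
    constructor
    · change -(|r| + 1) < x i
      linarith
    · change x i ≤ |r| + 1
      linarith
  refine eq_of_abs_sub_le_all fun ε hε => ?_
  have hδ : 0 < ε / (ν (Icc 0 1) + 1) := by positivity
  obtain ⟨U, hKU, hU, hUε⟩ := Set.exists_isOpen_lt_of_lt (μ := (volume : Measure (ι → ℝ)))
    (frontier K) (ENNReal.ofReal (ε / (ν (Icc 0 1) + 1)))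
    (by rw [hK'.addHaar_frontier volume]; exact ENNReal.ofReal_pos.2 hδ)
  have key := h.abs_sub_le_of_frontier_subset hK hK' hU hKU I
  rw [inter_eq_left.2 (hKI.trans Box.coe_subset_Icc), measureReal_def, measureReal_def,
    Measure.restrict_apply I.measurableSet_coe, Measure.restrict_apply I.measurableSet_coe,
    inter_eq_right.2 hKI] at key
  refine key.trans ?_
  have hle : (volume (I ∩ U : Set (ι → ℝ))).toReal ≤ ε / (ν (Icc 0 1) + 1) :=
    ENNReal.toReal_le_of_le_ofReal hδ.le ((measure_mono inter_subset_right).trans hUε.le)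
  calc ν (Icc 0 1) * (volume (I ∩ U : Set (ι → ℝ))).toReal
      ≤ (ν (Icc 0 1) + 1) * (ε / (ν (Icc 0 1) + 1)) := by gcongr; linarith
    _ = ε := by field_simp

end IsMonotoneCutAdditive

section constOn

variable {n : ℕ} {μ : (En n → EReal) → ℝ}

theorem constOn_of_mem {t : ℝ} {K : Set (En n)} {x : En n} (hx : x ∈ K) :
    constOn t K x = t := if_pos hx

theorem constOn_of_notMem {t : ℝ} {K : Set (En n)} {x : En n} (hx : x ∉ K) :
    constOn t K x = ⊤ := if_neg hx

theorem constOn_empty (t : ℝ) : constOn t (∅ : Set (En n)) = fun _ => ⊤ :=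
  funext fun x => constOn_of_notMem (notMem_empty x)

theorem constOn_ne_bot (t : ℝ) (K : Set (En n)) (x : En n) : constOn t K x ≠ ⊥ := by
  by_cases hx : x ∈ K
  · simp [constOn_of_mem hx]
  · simp [constOn_of_notMem hx]

theorem constOn_anti {t : ℝ} {K L : Set (En n)} (h : K ⊆ L) (x : En n) :
    constOn t L x ≤ constOn t K x := by
  by_cases hx : x ∈ K
  · rw [constOn_of_mem hx, constOn_of_mem (h hx)]
  · rw [constOn_of_notMem hx]
    exact le_top

theorem constOn_mono {s t : ℝ} (h : s ≤ t) (K : Set (En n)) (x : En n) :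
    constOn s K x ≤ constOn t K x := by
  by_cases hx : x ∈ K
  · simpa [constOn_of_mem hx] using h
  · simp [constOn_of_notMem hx]

theorem max_constOn (t : ℝ) (K L : Set (En n)) :
    (fun x => max (constOn t K x) (constOn t L x)) = constOn t (K ∩ L) := by
  ext x
  by_cases hK : x ∈ K <;> by_cases hL : x ∈ L <;> simp [constOn, hK, hL]

theorem min_constOn (t : ℝ) (K L : Set (En n)) :
    (fun x => min (constOn t K x) (constOn t L x)) = constOn t (K ∪ L) := by
  ext x
  by_cases hK : x ∈ K <;> by_cases hL : x ∈ L <;> simp [constOn, hK, hL]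

theorem dom_constOn (t : ℝ) (K : Set (En n)) : {x | constOn t K x ≠ ⊤} = K := by
  ext x
  by_cases hx : x ∈ K <;> simp [constOn, hx]

theorem isCn_constOn (t : ℝ) {K : Set (En n)} (hK : IsCompact K) (hK' : Convex ℝ K) :
    IsCn (constOn t K) := by
  refine ⟨constOn_ne_bot t K, fun x y a b ha hb hab => ?_, ?_, ?_⟩
  · have hbot : ∀ (c : ℝ) (z : En n), 0 ≤ c → (c : EReal) * constOn t K z ≠ ⊥ := by
      intro c z hc
      by_cases hz : z ∈ K
      · rw [constOn_of_mem hz, ← EReal.coe_mul]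
        exact EReal.coe_ne_bot _
      · rw [constOn_of_notMem hz]
        rcases hc.eq_or_lt with rfl | hc
        · simp
        · simp [EReal.coe_mul_top_of_pos hc]
    rcases ha.eq_or_lt with rfl | ha
    · obtain rfl : b = 1 := by linarith
      simp
    rcases hb.eq_or_lt with rfl | hb
    · obtain rfl : a = 1 := by linarith
      simp
    by_cases hx : x ∈ K
    · by_cases hy : y ∈ K
      · rw [constOn_of_mem hx, constOn_of_mem hy,
          constOn_of_mem (hK' hx hy ha.le hb.le hab), ← EReal.coe_mul, ← EReal.coe_mul,
          ← EReal.coe_add, ← add_mul, hab, one_mul]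
      · rw [constOn_of_notMem hy, EReal.coe_mul_top_of_pos hb,
          EReal.add_top_of_ne_bot (hbot a x ha.le)]
        exact le_top
    · rw [constOn_of_notMem hx, EReal.coe_mul_top_of_pos ha,
        EReal.top_add_of_ne_bot (hbot b y hb.le)]
      exact le_top
  · refine lowerSemicontinuous_iff_isClosed_preimage.2 fun y => ?_
    by_cases hy : y = ⊤
    · simp [hy]
    by_cases hty : (t : EReal) ≤ y
    · convert hK.isClosed using 1
      ext x
      by_cases hx : x ∈ K <;> simp [constOn, hx, hty, hy]
    · convert isClosed_empty using 1
      ext x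
      by_cases hx : x ∈ K <;> simp [constOn, hx, hy, not_le.1 hty]
  · refine tendsto_atTop.2 fun c => ?_
    filter_upwards [hK.compl_mem_cocompact] with x hx
    rw [constOn_of_notMem hx]
    exact le_top

theorem interior_setOf_coord_eq (i : Fin n) (a : ℝ) :
    interior {x : En n | x i = a} = ∅ := by
  rw [eq_empty_iff_forall_notMem]
  intro x hx
  have hlim : Tendsto (fun s : ℝ => x + s • EuclideanSpace.single i (1 : ℝ)) (nhds 0)
      (nhds x) := by
    have : Continuous fun s : ℝ => x + s • EuclideanSpace.single i (1 : ℝ) := by fun_prop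
    simpa using this.tendsto 0
  obtain ⟨s, hs, hs0⟩ := ((hlim.mono_left nhdsWithin_le_nhds).eventually
    (mem_interior_iff_mem_nhds.1 hx) |>.and
      (self_mem_nhdsWithin : {(0 : ℝ)}ᶜ ∈ nhdsWithin 0 {0}ᶜ)).exists
  have h₁ : x ∈ {x : En n | x i = a} := interior_subset hx
  rw [mem_ofPred_eq] at h₁
  have h₂ : x i + s = a := by simpa using hs
  exact hs0 (by simp; linarith)

theorem isMonotoneCutAdditive_constOn (hval : IsValuation μ) (hinv : RigidInvariant μ)
    (hmono : MonotoneDecr μ) (hsimple : SimpleVal μ) (t : ℝ) :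
    IsMonotoneCutAdditive fun K : Set (Fin n → ℝ) =>
      μ (constOn t ((EuclideanSpace.equiv (Fin n) ℝ) ⁻¹' K)) := by
  set e := EuclideanSpace.equiv (Fin n) ℝ
  have hcompact : ∀ {K : Set (Fin n → ℝ)}, IsCompact K → IsCompact (e ⁻¹' K) :=
    fun hK => e.toHomeomorph.isCompact_preimage.2 hK
  have hconvex : ∀ {K : Set (Fin n → ℝ)}, Convex ℝ K → Convex ℝ (e ⁻¹' K) :=
    fun hK => hK.linear_preimage e.toLinearMap
  refine ⟨?_, fun K L hK hK' hL hL' hKL => ?_, fun K hK hK' i a => ?_, fun K hK hK' v => ?_⟩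
  · simp only [preimage_empty, constOn_empty]
    exact hval.1
  · exact hmono _ _ (isCn_constOn t (hcompact hK) (hconvex hK'))
      (isCn_constOn t (hcompact hL) (hconvex hL')) (constOn_anti (preimage_mono hKL))
  · have hlc : IsCompact (K ∩ {x | x i ≤ a}) :=
      hK.inter_right (isClosed_le (continuous_apply i) continuous_const)
    have hlv : Convex ℝ (K ∩ {x | x i ≤ a}) :=
      hK'.inter (convex_halfSpace_le (LinearMap.proj (R := ℝ) (φ := fun _ => ℝ) i).isLinear a)
    have huc : IsCompact (K ∩ {x | a ≤ x i}) :=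
      hK.inter_right (isClosed_le continuous_const (continuous_apply i))
    have huv : Convex ℝ (K ∩ {x | a ≤ x i}) :=
      hK'.inter (convex_halfSpace_ge (LinearMap.proj (R := ℝ) (φ := fun _ => ℝ) i).isLinear a)
    have hunion : (K ∩ {x | x i ≤ a}) ∪ (K ∩ {x | a ≤ x i}) = K := by
      rw [← inter_union_distrib_left, inter_eq_left]
      exact fun x _ => le_total (x i) a
    have h := hval.2 _ _ (isCn_constOn t (hcompact hlc) (hconvex hlv))
      (isCn_constOn t (hcompact huc) (hconvex huv)) (by
        rw [min_constOn, ← preimage_union, hunion]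
        exact isCn_constOn t (hcompact hK) (hconvex hK'))
    rw [min_constOn, max_constOn, ← preimage_union, hunion, ← preimage_inter,
      hsimple _ (isCn_constOn t (hcompact (hlc.inter huc)) (hconvex (hlv.inter huv))),
      zero_add] at h
    · exact h.symm
    · rw [dom_constOn, ← subset_empty_iff, ← interior_setOf_coord_eq i a]
      exact interior_mono fun x hx => le_antisymm hx.1.2 hx.2.2
  · exact hinv _ (isCn_constOn t (hcompact hK) (hconvex hK')) (LinearIsometryEquiv.refl ℝ _)
      (e.symm v)

theorem MContinuous.tendsto_constOn (hμ : MContinuous μ) {K : Set (En n)} (hK : IsCompact K)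
    (hK' : Convex ℝ K) {t : ℝ} {s : ℕ → ℝ} (hs : Antitone s)
    (hst : Tendsto s atTop (nhds t)) :
    Tendsto (fun i => μ (constOn (s i) K)) atTop (nhds (μ (constOn t K))) := by
  refine hμ _ _ (isCn_constOn t hK hK') (fun i => isCn_constOn _ hK hK')
    (fun i => constOn_mono (hs i.le_succ) K) (fun i => constOn_mono (hs.le_of_tendsto hst i) K)
    fun x _ => ?_
  by_cases hx : x ∈ K
  · simp only [constOn_of_mem hx]
    exact (continuous_coe_real_ereal.tendsto t).comp hst
  · simp only [constOn_of_notMem hx]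
    exact tendsto_const_nhds

end constOn

/-- If the values of an antitone function along one sequence tending from the right to `t` converge
to its value at `t`, the function is continuous from the right at `t`. -/
theorem Antitone.tendsto_nhdsGT_of_seq {f : ℝ → ℝ} (hf : Antitone f) {t : ℝ} {s : ℕ → ℝ}
    (hs : ∀ i, t < s i) (hst : Tendsto s atTop (nhds t))
    (hfs : Tendsto (fun i => f (s i)) atTop (nhds (f t))) :
    Tendsto f (nhdsWithin t (Ioi t)) (nhds (f t)) := by
  have h := hf.tendsto_nhdsGT t
  have h' := h.comp (tendsto_nhdsWithin_iff.2 ⟨hst, Eventually.of_forall hs⟩)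
  rwa [tendsto_nhds_unique h' hfs] at h

theorem stmt9 {n : ℕ} (μ : (En n → EReal) → ℝ)
    (hval : IsValuation μ) (hinv : RigidInvariant μ) (hmono : MonotoneDecr μ)
    (hsimple : SimpleVal μ) :
    ∃ f : ℝ → ℝ, (∀ t, 0 ≤ f t) ∧ (∀ s t : ℝ, s ≤ t → f t ≤ f s) ∧
      (∀ K : Set (En n), IsConvexBody K → ∀ t : ℝ,
        μ (constOn t K) = f t * (volume K).toReal) ∧
      (MContinuous μ → ∀ t₀ : ℝ,
        Tendsto f (nhdsWithin t₀ (Set.Ioi t₀)) (nhds (f t₀))) := by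
  set e := EuclideanSpace.equiv (Fin n) ℝ
  have hν := isMonotoneCutAdditive_constOn hval hinv hmono hsimple
  have hQ : IsCompact (e ⁻¹' Icc 0 1) := e.toHomeomorph.isCompact_preimage.2 isCompact_Icc
  have hQ' : Convex ℝ (e ⁻¹' Icc 0 1) := (convex_Icc 0 1).linear_preimage e.toLinearMap
  have hanti : Antitone fun t => μ (constOn t (e ⁻¹' Icc 0 1)) := fun s t hst =>
    hmono _ _ (isCn_constOn t hQ hQ') (isCn_constOn s hQ hQ') (constOn_mono hst _)
  refine ⟨fun t => μ (constOn t (e ⁻¹' Icc 0 1)),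
    fun t => (hν t).nonneg isCompact_Icc (convex_Icc _ _), fun s t hst => hanti hst,
    fun K hK t => ?_, fun hμ t => ?_⟩
  · have h := (hν t).eq_mul_volume (K := e.symm ⁻¹' K)
      (e.symm.toHomeomorph.isCompact_preimage.2 hK.2.1)
      (hK.2.2.linear_preimage e.symm.toLinearMap)
    have hvol : volume (e.symm ⁻¹' K) = volume K :=
      (PiLp.volume_preserving_toLp (Fin n)).measure_preimage
        hK.2.1.isClosed.measurableSet.nullMeasurableSet
    rw [hvol] at h
    exact h
  · refine hanti.tendsto_nhdsGT_of_seq (s := fun i : ℕ => t + 1 / ((i : ℝ) + 1))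
      (fun i => lt_add_of_pos_right t Nat.one_div_pos_of_nat) ?_ ?_
    · simpa using tendsto_const_nhds.add (tendsto_one_div_add_atTop_nhds_zero_nat (𝕜 := ℝ))
    · refine hμ.tendsto_constOn hQ hQ' (fun i j hij => ?_) ?_
      · exact add_le_add_right (Nat.one_div_le_one_div hij) t
      · simpa using tendsto_const_nhds.add (tendsto_one_div_add_atTop_nhds_zero_nat (𝕜 := ℝ))
end
end

section
/- Let P be a polytope in ℝⁿ with nonempty interior and let 𝒫 = {P₁, …, P_N} be a complete polytopal partition of P. Then 𝒫 is an inductive partition of P. -/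
open MeasureTheory Filter Set
open scoped ENNReal RealInnerProductSpace

noncomputable section

namespace InductivePartition

/-- The sets obtained from members of `P` by successively gluing convex bodies with no common
interior. -/
inductive Built {n : ℕ} (P : Set (Set (En n))) : Set (En n) → Prop
  | base {Q : Set (En n)} : Q ∈ P → IsConvexBody Q → Built P Q
  | union {A B : Set (En n)} : Built P A → Built P B → IsConvexBody (A ∪ B) →
      interior (A ∩ B) = ∅ → Built P (A ∪ B)

theorem Built.mono {n : ℕ} {P P' : Set (Set (En n))} (h : P ⊆ P') {K : Set (En n)}
    (hK : Built P K) : Built P' K := by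
  induction hK with
  | base hQ hb => exact .base (h hQ) hb
  | union _ _ hb hi ihA ihB => exact .union ihA ihB hb hi

theorem Built.exists_nat_seq {n : ℕ} {P : Set (Set (En n))} {K : Set (En n)} (hK : Built P K) :
    ∃ (l : ℕ) (H : ℕ → Set (En n)), H l = K ∧ (∀ i ≤ l, IsConvexBody (H i)) ∧
      ∀ i ≤ l, H i ∈ P ∨ ∃ j k, j < i ∧ k < i ∧ H i = H j ∪ H k ∧ interior (H j ∩ H k) = ∅ := by
  induction hK with
  | @base Q hQ hb => exact ⟨0, fun _ => Q, rfl, fun _ _ => hb, fun _ _ => .inl hQ⟩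
  | @union A B _ _ hb hi ihA ihB =>
    obtain ⟨l, H, hl, hH, hs⟩ := ihA
    obtain ⟨m, G, hm, hG, ht⟩ := ihB
    set F : ℕ → Set (En n) := fun i =>
      if i ≤ l then H i else if i ≤ l + m + 1 then G (i - (l + 1)) else A ∪ B with hF
    have hF1 : ∀ i ≤ l, F i = H i := fun i h => if_pos h
    have hF2 : ∀ i ≤ m, F (i + (l + 1)) = G i := fun i h => by
      simp only [hF]
      rw [if_neg (by omega), if_pos (by omega), Nat.add_sub_cancel]
    have hF3 : F (l + m + 2) = A ∪ B := by
      simp only [hF]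
      rw [if_neg (by omega), if_neg (by omega)]
    have hcases : ∀ i ≤ l + m + 2, i ≤ l ∨ (∃ j ≤ m, i = j + (l + 1)) ∨ i = l + m + 2 := by
      intro i h
      by_cases h1 : i ≤ l
      · exact .inl h1
      by_cases h2 : i = l + m + 2
      · exact .inr (.inr h2)
      · exact .inr (.inl ⟨i - (l + 1), by omega, by omega⟩)
    refine ⟨l + m + 2, F, hF3, fun i h => ?_, fun i h => ?_⟩
    · rcases hcases i h with h1 | ⟨j, hj, rfl⟩ | rfl
      · rw [hF1 i h1]; exact hH i h1
      · rw [hF2 j hj]; exact hG j hj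
      · rw [hF3]; exact hb
    · rcases hcases i h with h1 | ⟨j, hj, rfl⟩ | rfl
      · rw [hF1 i h1]
        rcases hs i h1 with h2 | ⟨a, b, ha, hb', hab⟩
        · exact .inl h2
        · refine .inr ⟨a, b, ha, hb', ?_⟩
          rwa [hF1 a (by omega), hF1 b (by omega)]
      · rw [hF2 j hj]
        rcases ht j hj with h2 | ⟨a, b, ha, hb', hab⟩
        · exact .inl h2
        · refine .inr ⟨a + (l + 1), b + (l + 1), by omega, by omega, ?_⟩
          rwa [hF2 a (by omega), hF2 b (by omega)]
      · refine .inr ⟨l, m + (l + 1), by omega, by omega, ?_⟩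
        rw [hF3, hF1 l le_rfl, hF2 m le_rfl, hl, hm]
        exact ⟨rfl, hi⟩

theorem Built.isInductivePartition {n : ℕ} {P : Finset (Set (En n))} {K : Set (En n)}
    (hP : IsConvexPartition K P) (hK : Built (P : Set (Set (En n))) K) :
    IsInductivePartition K P := by
  obtain ⟨l, H, hl, hH, hs⟩ := hK.exists_nat_seq
  refine ⟨hP, l, fun i => H i, by simpa using hl, fun i => hH i (Nat.le_of_lt_succ i.2),
    fun i => ?_⟩
  rcases hs i (Nat.le_of_lt_succ i.2) with h | ⟨j, k, hj, hk, h⟩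
  · exact .inl h
  · exact .inr ⟨⟨j, hj.trans i.2⟩, ⟨k, hk.trans i.2⟩, hj, hk, h⟩

/-- An open nonempty set is not covered by finitely many proper affine subspaces. -/
theorem exists_mem_forall_notMem_affineSubspace {n : ℕ} {ι : Type*} (I : Finset ι)
    (A : ι → AffineSubspace ℝ (En n)) {U : Set (En n)} (hU : IsOpen U) (hne : U.Nonempty) :
    ∃ z ∈ U, ∀ i ∈ I, A i ≠ ⊤ → z ∉ A i := by
  classical
  by_contra! hcon
  have hsub : U ⊆ ⋃ i ∈ I.filter (fun i => A i ≠ ⊤), (A i : Set (En n)) := by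
    intro z hz
    obtain ⟨i, hi, hA, hzi⟩ := hcon z hz
    exact mem_biUnion (Finset.mem_coe.2 (Finset.mem_filter.2 ⟨hi, hA⟩)) hzi
  have hzero : volume (⋃ i ∈ I.filter (fun i => A i ≠ ⊤), (A i : Set (En n))) = 0 := by
    refine (measure_biUnion_null_iff (Finset.countable_toSet _)).2 fun i hi => ?_
    exact Measure.addHaar_affineSubspace _ _ (Finset.mem_filter.1 hi).2
  exact (hU.measure_pos volume hne).ne' (measure_mono_null hsub hzero)

/-- A point of a convex hull on which a linear functional is maximal lies in the convex hull of
the generators maximizing the functional. -/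
theorem mem_convexHull_filter_of_le {E : Type*} [AddCommGroup E] [Module ℝ E] (S : Finset E)
    (f : E →ₗ[ℝ] ℝ) {y : E} (hy : y ∈ convexHull ℝ (S : Set E)) (hf : ∀ s ∈ S, f s ≤ f y) :
    y ∈ convexHull ℝ ((S.filter fun s => f s = f y : Finset E) : Set E) := by
  classical
  obtain ⟨w, hw0, hw1, hwy⟩ := Finset.mem_convexHull'.1 hy
  have hsum : ∑ s ∈ S, w s * (f y - f s) = 0 := by
    have h1 : ∑ s ∈ S, w s * f s = f y := by
      conv_rhs => rw [← hwy]
      simp [map_sum]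
    simp only [mul_sub, Finset.sum_sub_distrib, ← Finset.sum_mul, hw1, h1, one_mul, sub_self]
  have hz := (Finset.sum_eq_zero_iff_of_nonneg fun s hs =>
    mul_nonneg (hw0 s hs) (sub_nonneg.2 (hf s hs))).1 hsum
  have hne : ∀ s ∈ S, w s ≠ 0 → f s = f y := fun s hs h => by
    have := (mul_eq_zero.1 (hz s hs)).resolve_left h
    linarith
  refine Finset.mem_convexHull'.2 ⟨w, fun s hs => hw0 s (Finset.mem_filter.1 hs).1, ?_, ?_⟩
  · rw [Finset.sum_filter_of_ne hne, hw1]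
  · rw [Finset.sum_filter_of_ne fun s hs h => hne s hs fun h0 => h (by simp [h0]), hwy]

/-- A point outside a full-dimensional polytope is separated from it by a facet hyperplane. -/
theorem exists_containsFacet_of_notMem {n : ℕ} {Q : Set (En n)} (hQ : IsPolytope Q)
    (hint : (interior Q).Nonempty) {x : En n} (hx : x ∉ Q) :
    ∃ (v : En n) (c : ℝ), v ≠ 0 ∧ ContainsFacet v c Q ∧ (∀ q ∈ Q, ⟪v, q⟫ ≤ c) ∧
      (∀ q ∈ interior Q, ⟪v, q⟫ < c) ∧ c < ⟪v, x⟫ := by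
  classical
  obtain ⟨S, -, rfl⟩ := hQ
  set Q := convexHull ℝ (S : Set (En n)) with hQdef
  have hconv : Convex ℝ Q := convex_convexHull ℝ _
  have hclosed : IsClosed Q := (S.finite_toSet.isCompact_convexHull (𝕜 := ℝ)).isClosed
  obtain ⟨z, hz, hgen⟩ := exists_mem_forall_notMem_affineSubspace S.powerset
    (fun T => affineSpan ℝ (insert x (T : Set (En n)))) isOpen_interior hint
  obtain ⟨y, hys, hyf⟩ : (segment ℝ z x ∩ frontier Q).Nonempty := by
    by_contra hemp
    have hcover : segment ℝ z x ⊆ interior Q ∪ Qᶜ := fun p hp => by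
      by_cases hpQ : p ∈ Q
      · exact .inl (by_contra fun h => hemp ⟨p, hp, subset_closure hpQ, h⟩)
      · exact .inr hpQ
    obtain ⟨p, -, hp1, hp2⟩ := (convex_segment z x).isPreconnected _ _ isOpen_interior
      hclosed.isOpen_compl hcover ⟨z, left_mem_segment ℝ z x, hz⟩
      ⟨x, right_mem_segment ℝ z x, hx⟩
    exact hp2 (interior_subset hp1)
  have hyQ : y ∈ Q := hclosed.frontier_subset hyf
  obtain ⟨f, hf⟩ := geometric_hahn_banach_open_point hconv.interior isOpen_interior hyf.2
  have hle : ∀ q ∈ Q, f q ≤ f y := by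
    have hcl : closure (interior Q) ⊆ {q | f q ≤ f y} :=
      closure_minimal (fun q hq => (hf q hq).le) (isClosed_le f.continuous continuous_const)
    rw [hconv.closure_interior_eq_closure_of_nonempty_interior hint, hclosed.closure_eq] at hcl
    exact hcl
  obtain ⟨a, b, ha, hb, hab, rfl⟩ := hys
  have hb0 : b ≠ 0 := by
    rintro rfl
    have ha1 : a = 1 := by linarith
    subst ha1
    simp only [one_smul, zero_smul, add_zero] at hyf
    exact hyf.2 hz
  have ha0 : a ≠ 0 := by
    rintro rfl
    have hb1 : b = 1 := by linarith
    subst hb1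
    simp only [one_smul, zero_smul, zero_add] at hyQ
    exact hx hyQ
  set y := a • z + b • x with hydef
  have hfy : f y = a * f z + b * f x := by simp [hydef]
  have hzy : f z < f y := hf z hz
  have hxy : f y < f x := by
    have hb' : 0 < b := hb.lt_of_ne' hb0
    have haz : a = 1 - b := by linarith
    subst haz
    have : 0 < b * (f x - f z) := by linarith
    have h2 : 0 < f x - f z := (mul_pos_iff_of_pos_left hb').1 this
    have h3 : 0 < (1 - b) * (f x - f z) := mul_pos (ha.lt_of_ne' ha0) h2
    linarith
  set T := S.filter fun s => f s = f y with hT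
  have hyT : y ∈ affineSpan ℝ (T : Set (En n)) := convexHull_subset_affineSpan _
    (mem_convexHull_filter_of_le S f.toLinearMap hyQ
      fun s hs => hle s (subset_convexHull ℝ _ hs))
  have htop : affineSpan ℝ (insert x (T : Set (En n))) = ⊤ := by
    by_contra hne
    refine hgen T (Finset.mem_powerset.2 (Finset.filter_subset _ _)) hne ?_
    have hxm : x ∈ affineSpan ℝ (insert x (T : Set (En n))) :=
      subset_affineSpan ℝ _ (mem_insert _ _)
    have hym : y ∈ affineSpan ℝ (insert x (T : Set (En n))) :=
      affineSpan_mono ℝ (subset_insert _ _) hyT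
    have hline := AffineMap.lineMap_mem (k := ℝ) a⁻¹ hxm hym
    convert hline using 1
    have hb1 : b = 1 - a := by linarith
    rw [AffineMap.lineMap_apply_module, hydef, hb1, smul_add, smul_smul, smul_smul,
      inv_mul_cancel₀ ha0, one_smul, mul_sub, inv_mul_cancel₀ ha0, mul_one]
    module
  set v := (InnerProductSpace.toDual ℝ (En n)).symm f with hv
  have hvf : ∀ q, ⟪v, q⟫ = f q := fun q => InnerProductSpace.toDual_symm_apply
  have hf0 : f.toLinearMap ≠ 0 := by
    intro h0
    have h1 : ∀ q, f q = 0 := fun q => LinearMap.congr_fun h0 q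
    rw [h1, h1] at hzy
    exact lt_irrefl _ hzy
  refine ⟨v, f y, ?_, ⟨.inl fun q hq => ?_, ?_⟩, fun q hq => ?_, fun q hq => ?_, ?_⟩
  · rintro h0
    have := hvf z
    have h2 := hvf y
    rw [h0, inner_zero_left] at this h2
    linarith
  · exact (hvf q).trans_le (hle q hq)
  · rw [show {q | ⟪v, q⟫ = f y} = {q | f q = f y} by ext q; simp [hvf], direction_affineSpan]
    have hker : vectorSpan ℝ (Q ∩ {q | f q = f y}) ≤ LinearMap.ker f.toLinearMap := by
      rw [vectorSpan, Submodule.span_le]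
      rintro _ ⟨p, hp, q, hq, rfl⟩
      have h1 : f p = f y := hp.2
      have h2 : f q = f y := hq.2
      simp [h1, h2]
    have hup := Submodule.finrank_mono hker
    have hkd := Module.Dual.finrank_ker_add_one_of_ne_zero hf0
    have hlow : vectorSpan ℝ (T : Set (En n)) ≤ vectorSpan ℝ (Q ∩ {q | f q = f y}) := by
      refine vectorSpan_mono ℝ fun s hs => ?_
      have hs' := Finset.mem_filter.1 (Finset.mem_coe.1 hs)
      exact ⟨subset_convexHull ℝ _ hs'.1, hs'.2⟩
    have hlo := Submodule.finrank_mono hlow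
    have hins := finrank_vectorSpan_insert_le_set ℝ (T : Set (En n)) x
    rw [← direction_affineSpan, htop, AffineSubspace.direction_top, finrank_top] at hins
    have hn : Module.finrank ℝ (En n) = n := finrank_euclideanSpace_fin
    rw [hn] at hins hkd
    omega
  · simpa only [hvf] using hle q hq
  · simpa only [hvf] using hf q hq
  · simpa only [hvf] using hxy

/-- If every member of a closed cover of a convex body lies on one side of a hyperplane, the
members on one side cover the corresponding part of the body. -/
theorem biUnion_filter_eq_inter {n : ℕ} {S : Finset (Set (En n))} {K : Set (En n)}
    (hK : Convex ℝ K) (hcl : ∀ Q ∈ S, IsClosed Q) (hS : ⋃ Q ∈ S, Q = K) {f : En n →L[ℝ] ℝ}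
    {c : ℝ} (hside : ∀ Q ∈ S, Q ⊆ {x | f x ≤ c} ∨ Q ⊆ {x | c ≤ f x})
    (hne : (interior K ∩ {x | f x < c}).Nonempty)
    [DecidablePred fun Q : Set (En n) => Q ⊆ {x | f x ≤ c}] :
    ⋃ Q ∈ S.filter (fun Q => Q ⊆ {x | f x ≤ c}), Q = K ∩ {x | f x ≤ c} := by
  apply Subset.antisymm
  · refine iUnion₂_subset fun Q hQ => ?_
    obtain ⟨h1, h2⟩ := Finset.mem_filter.1 hQ
    exact subset_inter (hS ▸ subset_biUnion_of_mem (u := fun Q => Q) h1) h2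
  · have hclosed : IsClosed (⋃ Q ∈ S.filter (fun Q => Q ⊆ {x | f x ≤ c}), Q) :=
      (Finset.finite_toSet _).isClosed_biUnion fun Q hQ => hcl Q (Finset.mem_filter.1 hQ).1
    have hsub : interior K ∩ {x | f x < c} ⊆ ⋃ Q ∈ S.filter (fun Q => Q ⊆ {x | f x ≤ c}), Q := by
      rintro x ⟨hx, hxc⟩
      have hxK : x ∈ ⋃ Q ∈ S, Q := hS ▸ interior_subset hx
      obtain ⟨Q, hQ, hxQ⟩ := mem_iUnion₂.1 hxK
      refine mem_iUnion₂.2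
        ⟨Q, Finset.mem_filter.2 ⟨hQ, (hside Q hQ).resolve_right fun h => ?_⟩, hxQ⟩
      exact not_lt.2 (show c ≤ f x from h hxQ) hxc
    obtain ⟨p, hp⟩ := hne
    intro x hx
    refine hclosed.closure_subset_iff.2 hsub ?_
    have hseg : openSegment ℝ p x ⊆ interior K ∩ {x | f x < c} := by
      intro q hq
      refine ⟨hK.openSegment_interior_self_subset_interior hp.1 hx.1 hq, ?_⟩
      obtain ⟨a, b, ha, hb, hab, rfl⟩ := hq
      have h1 : f p < c := hp.2
      have h2 : f x ≤ c := hx.2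
      have h3 : f (a • p + b • x) = a * f p + b * f x := by simp
      have hb1 : b = 1 - a := by linarith
      have hlt : a * f p < a * c := mul_lt_mul_of_pos_left h1 ha
      have hle : b * f x ≤ b * c := mul_le_mul_of_nonneg_left h2 hb.le
      have hc : a * c + b * c = c := by rw [← add_mul, hab, one_mul]
      change f (a • p + b • x) < c
      linarith
    exact closure_mono hseg (segment_subset_closure_openSegment (right_mem_segment ℝ p x))

/-- A family of full-dimensional polytopes, none of which is cut by a facet hyperplane of another,
can be glued inductively whenever its union is convex. -/
theorem built_of_forall_facet {n : ℕ} (S : Finset (Set (En n))) :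
    ∀ K : Set (En n), IsConvexBody K → (interior K).Nonempty → ⋃ Q ∈ S, Q = K →
      (∀ Q ∈ S, IsConvexBody Q ∧ IsPolytope Q ∧ (interior Q).Nonempty) →
      (∀ (v : En n) (c : ℝ), v ≠ 0 → (∃ Q ∈ S, ContainsFacet v c Q) →
        ∀ R ∈ S, R ⊆ {x | ⟪v, x⟫ ≤ c} ∨ R ⊆ {x | c ≤ ⟪v, x⟫}) →
      Built (S : Set (Set (En n))) K := by
  classical
  induction S using Finset.strongInduction with
  | H S ih =>
    intro K hK hKint hS hpoly hcut
    have hQK : ∀ Q ∈ S, Q ⊆ K := fun Q hQ => hS ▸ subset_biUnion_of_mem (u := fun Q => Q) hQ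
    by_cases hKS : K ∈ S
    · exact .base hKS hK
    obtain ⟨Q, hQ⟩ : S.Nonempty := by
      rw [Finset.nonempty_iff_ne_empty]
      rintro rfl
      obtain ⟨p, hp⟩ := hK.1
      rw [← hS] at hp
      simp at hp
    obtain ⟨x, hxK, hxQ⟩ : ∃ x ∈ K, x ∉ Q := by
      by_contra! h
      exact hKS (Subset.antisymm (hQK Q hQ) h ▸ hQ)
    obtain ⟨v, c, hv, hfacet, hle, hlt, hxc⟩ :=
      exists_containsFacet_of_notMem (hpoly Q hQ).2.1 (hpoly Q hQ).2.2 hxQ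
    have hside := hcut v c hv ⟨Q, hQ, hfacet⟩
    set f : En n →L[ℝ] ℝ := innerSL ℝ v with hf
    have hfv : ∀ q, ⟪v, q⟫ = f q := fun q => rfl
    simp only [hfv] at hside hle hlt hxc
    have hclosed : ∀ R ∈ S, IsClosed R := fun R hR => (hpoly R hR).1.2.1.isClosed
    obtain ⟨q, hq⟩ := (hpoly Q hQ).2.2
    have hne1 : (interior K ∩ {x | f x < c}).Nonempty :=
      ⟨q, interior_mono (hQK Q hQ) hq, hlt q hq⟩
    have hopen1 : IsOpen {x | f x < c} := isOpen_lt f.continuous continuous_const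
    have hopen2 : IsOpen {x | c < f x} := isOpen_lt continuous_const f.continuous
    have hne2 : (interior K ∩ {x | c < f x}).Nonempty := by
      have hx : x ∈ closure (interior K) := by
        rw [hK.2.2.closure_interior_eq_closure_of_nonempty_interior hKint]
        exact subset_closure hxK
      obtain ⟨p, hp1, hp2⟩ := mem_closure_iff.1 hx _ hopen2 hxc
      exact ⟨p, hp2, hp1⟩
    have hU1 := biUnion_filter_eq_inter hK.2.2 hclosed hS hside hne1
    have hU2 : ⋃ Q ∈ S.filter (fun Q => Q ⊆ {x | c ≤ f x}), Q = K ∩ {x | c ≤ f x} := by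
      have h := biUnion_filter_eq_inter (f := -f) (c := -c) hK.2.2 hclosed hS
        (by simpa [or_comm] using hside) (by simpa using hne2)
      simpa using h
    have hclosed1 : IsClosed {x | f x ≤ c} := isClosed_le f.continuous continuous_const
    have hclosed2 : IsClosed {x | c ≤ f x} := isClosed_le continuous_const f.continuous
    have hint1 : (interior (K ∩ {x | f x ≤ c})).Nonempty := hne1.mono <|
      interior_maximal (inter_subset_inter interior_subset fun x (hx : f x < c) => show f x ≤ c from hx.le)
        (isOpen_interior.inter hopen1)
    have hint2 : (interior (K ∩ {x | c ≤ f x})).Nonempty := hne2.mono <|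
      interior_maximal (inter_subset_inter interior_subset fun x (hx : c < f x) => show c ≤ f x from hx.le)
        (isOpen_interior.inter hopen2)
    have hbody1 : IsConvexBody (K ∩ {x | f x ≤ c}) :=
      ⟨hint1.mono interior_subset, hK.2.1.inter_right hclosed1,
        hK.2.2.inter (convex_halfSpace_le f.toLinearMap.isLinear c)⟩
    have hbody2 : IsConvexBody (K ∩ {x | c ≤ f x}) :=
      ⟨hint2.mono interior_subset, hK.2.1.inter_right hclosed2,
        hK.2.2.inter (convex_halfSpace_ge f.toLinearMap.isLinear c)⟩
    have hss1 : S.filter (fun Q => Q ⊆ {x | f x ≤ c}) ⊂ S := by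
      refine Finset.filter_ssubset.2 ?_
      by_contra! h
      obtain ⟨p, hp, hpc⟩ := hne2
      rw [Finset.filter_true_of_mem h, hS] at hU1
      have hpK : p ∈ K ∩ {x | f x ≤ c} := hU1 ▸ interior_subset hp
      exact not_lt.2 (show f p ≤ c from hpK.2) hpc
    have hss2 : S.filter (fun Q => Q ⊆ {x | c ≤ f x}) ⊂ S := by
      refine Finset.filter_ssubset.2 ⟨Q, hQ, fun h => ?_⟩
      exact not_lt.2 (show c ≤ f q from h (interior_subset hq)) (hlt q hq)
    have hsub : ∀ S' ⊂ S, ∀ K', IsConvexBody K' → (interior K').Nonempty → ⋃ Q ∈ S', Q = K' →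
        Built (S : Set (Set (En n))) K' := fun S' hS' K' hK' hi hU =>
      (ih S' hS' K' hK' hi hU (fun R hR => hpoly R (hS'.1 hR)) fun w d hw ⟨R, hR, hRf⟩ T hT =>
        hcut w d hw ⟨R, hS'.1 hR, hRf⟩ T (hS'.1 hT)).mono (Finset.coe_subset.2 hS'.1)
    have hunion : K ∩ {x | f x ≤ c} ∪ K ∩ {x | c ≤ f x} = K := by
      rw [← inter_union_distrib_left]
      exact inter_eq_left.2 fun p _ => le_total (f p) c
    have hinter : interior ((K ∩ {x | f x ≤ c}) ∩ (K ∩ {x | c ≤ f x})) = ∅ := by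
      have hf0 : f ≠ 0 := fun h => hv (by
        have : f v = 0 := by rw [h]; rfl
        exact inner_self_eq_zero.1 this)
      have hfo : IsOpenMap f := f.isOpenMap_of_ne_zero hf0
      rw [eq_empty_iff_forall_notMem]
      intro p hp
      have hsubs : f '' interior ((K ∩ {x | f x ≤ c}) ∩ (K ∩ {x | c ≤ f x})) ⊆ {c} := by
        rintro _ ⟨r, hr, rfl⟩
        have hr' := interior_subset hr
        exact le_antisymm hr'.1.2 hr'.2.2
      have := interior_maximal hsubs (hfo _ isOpen_interior) ⟨p, hp, rfl⟩
      simp at this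
    rw [← hunion]
    exact .union (hsub _ hss1 _ hbody1 hint1 hU1) (hsub _ hss2 _ hbody2 hint2 hU2)
      (by rwa [hunion]) hinter

end InductivePartition

theorem stmt10 {n : ℕ} (P : Set (En n)) (hP : IsPolytope P)
    (hint : (interior P).Nonempty)
    (Ppart : Finset (Set (En n))) (hpart : IsConvexPartition P Ppart)
    (hpoly : ∀ Q ∈ Ppart, IsPolytope Q ∧ (interior Q).Nonempty)
    (hcomplete : ∀ (v : En n) (c : ℝ), v ≠ 0 →
      (∃ Q ∈ Ppart, ContainsFacet v c Q) → refinePartition Ppart v c = Ppart) :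
    IsInductivePartition P Ppart := by
  refine InductivePartition.Built.isInductivePartition hpart
    (InductivePartition.built_of_forall_facet Ppart P ?_ hint hpart.2.1
      (fun Q hQ => ⟨hpart.1 Q hQ, hpoly Q hQ⟩) fun v c hv hQ R hR => ?_)
  · obtain ⟨S, hS, rfl⟩ := hP
    exact ⟨(Finset.coe_nonempty.2 hS).convexHull, S.finite_toSet.isCompact_convexHull ℝ, convex_convexHull ℝ _⟩
  · rw [← hcomplete v c hv hQ] at hR
    simp only [refinePartition, Finset.mem_union, Finset.mem_filter, Finset.mem_image] at hR
    rcases hR with ⟨⟨R', -, rfl⟩, -⟩ | ⟨⟨R', -, rfl⟩, -⟩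
    · exact .inl inter_subset_right
    · exact .inr inter_subset_right
end
end

section
/- Let σ : 𝒦ⁿ → ℝ be a valuation on convex bodies which is nonnegative and simple. Then σ is monotone increasing on polytopes: for all polytopes P, Q in ℝⁿ with P ⊆ Q, one has σ(P) ≤ σ(Q). -/
open MeasureTheory Filter Set
open scoped ENNReal RealInnerProductSpace

noncomputable section

/-- Fourier–Motzkin elimination: the Minkowski sum of a finite intersection of linear half-spaces
with a ray is again a finite intersection of linear half-spaces. -/
lemma exists_finset_dual_add_ray {V : Type*} [AddCommGroup V] [Module ℝ V]
    (T : Finset (V →ₗ[ℝ] ℝ)) (v : V) :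
    ∃ T' : Finset (V →ₗ[ℝ] ℝ), ∀ x : V,
      (∃ t : ℝ, 0 ≤ t ∧ ∀ f ∈ T, 0 ≤ f (x - t • v)) ↔ ∀ f ∈ T', 0 ≤ f x := by
  classical
  let N := T.filter fun f => f v < 0
  refine ⟨(T.filter fun f => 0 ≤ f v) ∪
    Finset.image₂ (fun f g => f v • g - g v • f) (T.filter fun f => 0 < f v) N, fun x => ?_⟩
  constructor
  · rintro ⟨t, ht, hx⟩ h hh
    simp only [map_sub, map_smul, smul_eq_mul] at hx
    rcases Finset.mem_union.1 hh with hh | hh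
    · obtain ⟨hT, hv⟩ := Finset.mem_filter.1 hh
      nlinarith [hx h hT, mul_nonneg ht hv]
    · obtain ⟨f, hf, g, hg, rfl⟩ := Finset.mem_image₂.1 hh
      obtain ⟨hf, hfv⟩ := Finset.mem_filter.1 hf
      obtain ⟨hg, hgv⟩ := Finset.mem_filter.1 hg
      simp only [LinearMap.sub_apply, LinearMap.smul_apply, smul_eq_mul]
      nlinarith [mul_nonneg hfv.le (hx g hg), mul_nonneg (neg_nonneg.2 hgv.le) (hx f hf)]
  · intro hx
    have hpos : ∀ f ∈ T, 0 ≤ f v → 0 ≤ f x := fun f hf hfv =>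
      hx f (Finset.mem_union_left _ (Finset.mem_filter.2 ⟨hf, hfv⟩))
    have hmix : ∀ f ∈ T, 0 < f v → ∀ g ∈ T, g v < 0 → g v * f x ≤ f v * g x := by
      intro f hf hfv g hg hgv
      have := hx _ (Finset.mem_union_right _ (Finset.mem_image₂_of_mem
        (Finset.mem_filter.2 ⟨hf, hfv⟩) (Finset.mem_filter.2 ⟨hg, hgv⟩)))
      simpa using this
    have hB : (insert 0 (N.image fun g => g x / g v)).Nonempty := Finset.insert_nonempty _ _
    obtain ⟨t, htB, htmax⟩ := Finset.exists_max_image _ id hB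
    have ht : 0 ≤ t := htmax 0 (Finset.mem_insert_self _ _)
    refine ⟨t, ht, fun f hf => ?_⟩
    simp only [map_sub, map_smul, smul_eq_mul]
    rcases lt_trichotomy (f v) 0 with hfv | hfv | hfv
    · have := htmax (f x / f v) (Finset.mem_insert_of_mem
        (Finset.mem_image_of_mem _ (Finset.mem_filter.2 ⟨hf, hfv⟩)))
      have := (div_le_iff_of_neg hfv).1 this
      simpa using this
    · simpa [hfv] using hpos f hf hfv.ge
    · rcases Finset.mem_insert.1 htB with rfl | htB
      · simpa using hpos f hf hfv.le
      · obtain ⟨g, hg, rfl⟩ := Finset.mem_image.1 htB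
        obtain ⟨hg, hgv⟩ := Finset.mem_filter.1 hg
        have := hmix f hf hfv g hg hgv
        rw [sub_nonneg, div_mul_eq_mul_div, div_le_iff_of_neg hgv]
        linarith

/-- Weyl's theorem: a finitely generated cone in a finite-dimensional space is a finite
intersection of linear half-spaces. -/
lemma exists_finset_dual_conicCombination {V ι : Type*} [AddCommGroup V] [Module ℝ V]
    [FiniteDimensional ℝ V] (g : ι → V) (s : Finset ι) :
    ∃ T : Finset (V →ₗ[ℝ] ℝ), ∀ x : V,
      (∃ w : ι → ℝ, (∀ i ∈ s, 0 ≤ w i) ∧ ∑ i ∈ s, w i • g i = x) ↔ ∀ f ∈ T, 0 ≤ f x := by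
  classical
  induction s using Finset.induction_on with
  | empty =>
    let b := Module.finBasis ℝ V
    refine ⟨Finset.univ.image b.coord ∪ Finset.univ.image fun i => -b.coord i, fun x => ?_⟩
    constructor
    · rintro ⟨w, -, rfl⟩
      simp
    · intro hx
      refine ⟨0, by simp, ?_⟩
      rw [Finset.sum_empty, eq_comm, ← b.forall_coord_eq_zero_iff]
      intro i
      refine le_antisymm ?_ (hx _ (Finset.mem_union_left _
        (Finset.mem_image_of_mem _ (Finset.mem_univ i))))
      have := hx _ (Finset.mem_union_right _
        (Finset.mem_image_of_mem (fun i => -b.coord i) (Finset.mem_univ i)))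
      simpa using this
  | insert a s ha ih =>
    obtain ⟨T, hT⟩ := ih
    obtain ⟨T', hT'⟩ := exists_finset_dual_add_ray T (g a)
    refine ⟨T', fun x => ?_⟩
    rw [← hT']
    constructor
    · rintro ⟨w, hw, rfl⟩
      refine ⟨w a, hw a (Finset.mem_insert_self _ _), (hT _).1 ⟨w, fun i hi =>
        hw i (Finset.mem_insert_of_mem hi), ?_⟩⟩
      rw [Finset.sum_insert ha, add_sub_cancel_left]
    · rintro ⟨t, ht, hx⟩
      obtain ⟨w, hw, hwx⟩ := (hT _).2 hx
      have hne : ∀ i ∈ s, i ≠ a := fun i hi => ne_of_mem_of_not_mem hi ha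
      refine ⟨Function.update w a t, fun i hi => ?_, ?_⟩
      · rcases Finset.mem_insert.1 hi with rfl | hi
        · simpa using ht
        · simpa [hne i hi] using hw i hi
      · rw [Finset.sum_insert ha, Function.update_self, Finset.sum_congr rfl fun i hi => by
          rw [Function.update_of_ne (hne i hi)], hwx, add_sub_cancel]

/-- The convex hull of a finite set is a finite intersection of closed half-spaces. -/
lemma exists_finset_affineMap_convexHull {E : Type*} [AddCommGroup E] [Module ℝ E]
    [FiniteDimensional ℝ E] (S : Finset E) :
    ∃ T : Finset (E →ᵃ[ℝ] ℝ), convexHull ℝ (S : Set E) = {x | ∀ f ∈ T, 0 ≤ f x} := by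
  classical
  obtain ⟨T, hT⟩ := exists_finset_dual_conicCombination (fun y : E => (y, (1 : ℝ))) S
  let j : E →ᵃ[ℝ] E × ℝ := (AffineMap.id ℝ E).prod (AffineMap.const ℝ E 1)
  refine ⟨T.image fun f => f.toAffineMap.comp j, ?_⟩
  ext x
  have := hT (x, 1)
  simp only [Prod.ext_iff, Prod.fst_sum, Prod.snd_sum, Prod.smul_mk, smul_eq_mul, mul_one] at this
  simp only [Finset.mem_convexHull', mem_ofPred_eq, Finset.forall_mem_image]
  refine Iff.trans ?_ this
  simp only [and_comm]

lemma interior_affineMap_eq_empty {E : Type*} [NormedAddCommGroup E] [NormedSpace ℝ E]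
    [FiniteDimensional ℝ E] {f : E →ᵃ[ℝ] ℝ} (hf : f.linear ≠ 0) (c : ℝ) :
    interior {x | f x = c} = ∅ := by
  have hopen : IsOpenMap f := AffineMap.isOpenMap_linear_iff.1
    (f.linear.isOpenMap_of_finiteDimensional (LinearMap.surjective hf))
  have := hopen.interior_preimage_subset_preimage_interior (s := {c})
  rw [interior_singleton, preimage_empty, subset_empty_iff] at this
  exact this

lemma IsConvexBody.inter {n : ℕ} {K H : Set (En n)} (hK : IsConvexBody K) (hH : IsClosed H)
    (hHc : Convex ℝ H) (hne : (K ∩ H).Nonempty) : IsConvexBody (K ∩ H) :=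
  ⟨hne, hK.2.1.inter_right hH, hK.2.2.inter hHc⟩

lemma simpleValuation_inter_halfspace_le
    {n : ℕ} {σ : Set (En n) → ℝ} (hempty : σ ∅ = 0)
    (hval : ∀ K L : Set (En n), IsConvexBody K → IsConvexBody L →
      IsConvexBody (K ∪ L) → σ (K ∪ L) + σ (K ∩ L) = σ K + σ L)
    (hnonneg : ∀ K : Set (En n), IsConvexBody K → 0 ≤ σ K)
    (hsimple : ∀ K : Set (En n), IsConvexBody K → interior K = ∅ → σ K = 0)
    {K : Set (En n)} (hK : IsConvexBody K)
    (f : En n →ᵃ[ℝ] ℝ) (hne : (K ∩ {x | 0 ≤ f x}).Nonempty) :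
    σ (K ∩ {x | 0 ≤ f x}) ≤ σ K := by
  by_cases hf : f.linear = 0
  · obtain ⟨c, rfl⟩ := (AffineMap.linear_eq_zero_iff_exists_const f).1 hf
    obtain ⟨x, -, hx⟩ := hne
    have : K ∩ {x | 0 ≤ AffineMap.const ℝ (En n) c x} = K :=
      inter_eq_left.2 fun _ _ => hx
    rw [this]
  have hcont : Continuous f := f.continuous_of_finiteDimensional
  have hupper : IsConvexBody (K ∩ {x | 0 ≤ f x}) :=
    hK.inter (isClosed_le continuous_const hcont) ((convex_Ici 0).affine_preimage f) hne
  by_cases hne' : (K ∩ {x | f x ≤ 0}).Nonempty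
  · have hlower : IsConvexBody (K ∩ {x | f x ≤ 0}) :=
      hK.inter (isClosed_le hcont continuous_const) ((convex_Iic 0).affine_preimage f) hne'
    have hunion : (K ∩ {x | 0 ≤ f x}) ∪ (K ∩ {x | f x ≤ 0}) = K := by
      rw [← inter_union_distrib_left]
      exact inter_eq_left.2 fun x _ => le_total 0 (f x)
    have hinter : (K ∩ {x | 0 ≤ f x}) ∩ (K ∩ {x | f x ≤ 0}) = K ∩ {x | f x = 0} := by
      ext x
      simp only [mem_inter_iff, mem_ofPred_eq, le_antisymm_iff]
      tauto
    have hzero : σ (K ∩ {x | f x = 0}) = 0 := by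
      rcases (K ∩ {x | f x = 0}).eq_empty_or_nonempty with h | h
      · rw [h, hempty]
      · refine hsimple _ (hK.inter (isClosed_eq hcont continuous_const)
          ((convex_singleton 0).affine_preimage f) h) ?_
        rw [interior_inter, interior_affineMap_eq_empty hf, inter_empty]
    have := hval _ _ hupper hlower (by rwa [hunion])
    rw [hunion, hinter, hzero] at this
    linarith [hnonneg _ hlower]
  · have : K ∩ {x | 0 ≤ f x} = K := inter_eq_left.2 fun x hx =>
      (le_total 0 (f x)).resolve_right fun h => hne' ⟨x, hx, h⟩
    rw [this]

lemma simpleValuation_inter_polyhedron_le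
    {n : ℕ} {σ : Set (En n) → ℝ} (hempty : σ ∅ = 0)
    (hval : ∀ K L : Set (En n), IsConvexBody K → IsConvexBody L →
      IsConvexBody (K ∪ L) → σ (K ∪ L) + σ (K ∩ L) = σ K + σ L)
    (hnonneg : ∀ K : Set (En n), IsConvexBody K → 0 ≤ σ K)
    (hsimple : ∀ K : Set (En n), IsConvexBody K → interior K = ∅ → σ K = 0)
    (T : Finset (En n →ᵃ[ℝ] ℝ)) {K : Set (En n)}
    (hK : IsConvexBody K) (hne : (K ∩ {x | ∀ f ∈ T, 0 ≤ f x}).Nonempty) :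
    σ (K ∩ {x | ∀ f ∈ T, 0 ≤ f x}) ≤ σ K := by
  classical
  induction T using Finset.induction_on generalizing K with
  | empty => simp
  | insert a T _ ih =>
    have hset : K ∩ {x | ∀ f ∈ insert a T, 0 ≤ f x} =
        (K ∩ {x | 0 ≤ a x}) ∩ {x | ∀ f ∈ T, 0 ≤ f x} := by
      simp only [Finset.forall_mem_insert, ofPred_and, inter_assoc]
    rw [hset] at hne ⊢
    have hcut : IsConvexBody (K ∩ {x | 0 ≤ a x}) :=
      hK.inter (isClosed_le continuous_const a.continuous_of_finiteDimensional)
        ((convex_Ici 0).affine_preimage a) hne.left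
    exact (ih hcut hne).trans
      (simpleValuation_inter_halfspace_le hempty hval hnonneg hsimple hK a hne.left)

theorem stmt13 {n : ℕ} (σ : Set (En n) → ℝ) (hempty : σ ∅ = 0)
    (hval : ∀ K L : Set (En n), IsConvexBody K → IsConvexBody L →
      IsConvexBody (K ∪ L) → σ (K ∪ L) + σ (K ∩ L) = σ K + σ L)
    (hnonneg : ∀ K : Set (En n), IsConvexBody K → 0 ≤ σ K)
    (hsimple : ∀ K : Set (En n), IsConvexBody K → interior K = ∅ → σ K = 0)
    (P Q : Set (En n)) (hP : IsPolytope P) (hQ : IsPolytope Q) (hPQ : P ⊆ Q) :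
    σ P ≤ σ Q := by
  obtain ⟨S, hS, rfl⟩ := hP
  obtain ⟨S', hS', rfl⟩ := hQ
  obtain ⟨T, hT⟩ := exists_finset_affineMap_convexHull S
  have hQ : IsConvexBody (convexHull ℝ (S' : Set (En n))) :=
    ⟨hS'.to_set.convexHull, S'.finite_toSet.isCompact_convexHull ℝ, convex_convexHull ℝ _⟩
  have hinter := inter_eq_right.2 hPQ
  have hne : (convexHull ℝ (S : Set (En n))).Nonempty := hS.to_set.convexHull
  rw [← hinter, hT] at hne ⊢
  exact simpleValuation_inter_polyhedron_le hempty hval hnonneg hsimple T hQ hne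
end
end
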